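/- Let u be a nonnegative C^{2,1} function on B₄(0) × (0,3) ⊂ ℝⁿ × ℝ with Hu := u_t − Δu ≥ 0. Let φ₁ > 0 be the first Dirichlet eigenfunction of −Δ on B₃(0) with eigenvalue λ > 0 (φ₁ = 0 on |x| = 3). Then for all 0 < t ≤ 2, 0 ≤ ∫_{|x|<3}(Hu)(x,t)φ₁(x) dx ≤ U'(t) + λU(t), where U(t) = ∫_{|x|<3} u(x,t)φ₁(x) dx; consequently both uφ₁ and (Hu)φ₁ belong to L¹(B₃(0) × (0,2)), and in particular u and Hu belong to L¹(B₂(0) × (0,2)). -/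

import Mathlib

open MeasureTheory Real Set Metric Filter

/-- The Laplacian of `f : ℝⁿ → ℝ` at `x`, written as the sum of second partial
derivatives in the coordinate directions. -/
noncomputable def euclideanLaplacian {n : ℕ} (f : EuclideanSpace ℝ (Fin n) → ℝ)
    (x : EuclideanSpace ℝ (Fin n)) : ℝ :=
  ∑ i : Fin n, fderiv ℝ (fun z => fderiv ℝ f z (EuclideanSpace.single i 1)) x
    (EuclideanSpace.single i 1)

/-- A convex `C²` function vanishing below `ε` and staying within `2 * ε` of the identity
on `[0, ∞)`. -/
theorem exists_convex_truncation {ε : ℝ} (hε : 0 < ε) :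
    ∃ F : ℝ → ℝ, ContDiff ℝ 2 F ∧ (∀ s ≤ ε, F s = 0) ∧ (∀ s, 0 ≤ deriv F s) ∧
      (∀ s, deriv F s ≤ 1) ∧ (∀ s, 0 ≤ deriv (deriv F) s) ∧
      ∀ s, 0 ≤ s → |F s - s| ≤ 2 * ε := by
  set p : ℝ → ℝ := fun τ => smoothTransition (τ / ε - 1) with hp
  have hpsmooth : ContDiff ℝ 1 p :=
    (smoothTransition.contDiff (n := 1)).comp ((contDiff_id.div_const ε).sub contDiff_const)
  have hpc : Continuous p := hpsmooth.continuous
  have hpi : ∀ a b, IntervalIntegrable p volume a b := fun a b => hpc.intervalIntegrable a b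
  have hmono : Monotone p := fun a b hab =>
    smoothTransition.monotone (by gcongr)
  have hd : ∀ s, HasDerivAt (fun s => ∫ τ in (0:ℝ)..s, p τ) (p s) s := fun s =>
    intervalIntegral.integral_hasDerivAt_right (hpi 0 s)
      (hpc.stronglyMeasurableAtFilter _ _) hpc.continuousAt
  have hderiv : deriv (fun s => ∫ τ in (0:ℝ)..s, p τ) = p := funext fun s => (hd s).deriv
  have hnn : ∀ s, 0 ≤ p s := fun s => smoothTransition.nonneg _
  have hle : ∀ s, p s ≤ 1 := fun s => smoothTransition.le_one _
  refine ⟨fun s => ∫ τ in (0:ℝ)..s, p τ, ?_, ?_, ?_, ?_, ?_, ?_⟩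
  · rw [show (2 : WithTop ℕ∞) = 1 + 1 by norm_num, contDiff_succ_iff_deriv]
    refine ⟨fun s => (hd s).differentiableAt, by simp, ?_⟩
    rwa [hderiv]
  · intro s hs
    have : ∀ τ ∈ uIcc (0:ℝ) s, p τ = 0 := by
      intro τ hτ
      apply smoothTransition.zero_of_nonpos
      have : τ ≤ ε := by
        rcases le_total 0 s with h | h
        · rw [uIcc_of_le h] at hτ; exact hτ.2.trans hs
        · rw [uIcc_of_ge h] at hτ; exact hτ.2.trans hε.le
      rw [sub_nonpos, div_le_one hε]; exact this
    exact (intervalIntegral.integral_congr this).trans (by simp)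
  · rw [hderiv]; exact hnn
  · rw [hderiv]; exact hle
  · rw [hderiv]; exact fun s => hmono.deriv_nonneg
  · intro s hs
    have h1 : ∫ τ in (0:ℝ)..s, p τ ≤ s := by
      simpa using intervalIntegral.integral_mono_on hs (hpi 0 s)
        (intervalIntegrable_const (c := (1:ℝ))) (fun τ _ => hle τ)
    have h2 : s - 2 * ε ≤ ∫ τ in (0:ℝ)..s, p τ := by
      rcases le_total s (2 * ε) with h | h
      · exact (sub_nonpos.2 h).trans (intervalIntegral.integral_nonneg hs fun τ _ => hnn τ)
      · rw [← intervalIntegral.integral_add_adjacent_intervals (hpi 0 (2 * ε)) (hpi _ s)]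
        have h3 : 0 ≤ ∫ τ in (0:ℝ)..(2 * ε), p τ :=
          intervalIntegral.integral_nonneg (by positivity) fun τ _ => hnn τ
        have h4 : ∫ τ in (2 * ε)..s, p τ = s - 2 * ε := by
          have : ∀ τ ∈ uIcc (2 * ε) s, p τ = 1 := by
            intro τ hτ
            rw [uIcc_of_le h] at hτ
            apply smoothTransition.one_of_one_le
            rw [le_sub_iff_add_le, le_div_iff₀ hε]
            linarith [hτ.1]
          exact (intervalIntegral.integral_congr this).trans (by simp)
        linarith
    rw [abs_le]; constructor <;> linarith

/-- The second derivative of a `C²` function in any direction is nonnegative at a local minimum. -/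
theorem IsLocalMin.fderiv_fderiv_nonneg {E : Type*} [NormedAddCommGroup E] [NormedSpace ℝ E]
    {f : E → ℝ} {x : E} (hf : ContDiffAt ℝ 2 f x) (h : IsLocalMin f x) (v : E) :
    0 ≤ fderiv ℝ (fun z => fderiv ℝ f z v) x v := by
  have hline : ∀ s : ℝ, HasDerivAt (fun s : ℝ => x + s • v) v s := fun s => by
    simpa using ((hasDerivAt_id s).smul_const v).const_add x
  have hcont : Tendsto (fun s : ℝ => x + s • v) (nhds 0) (nhds x) := by
    simpa using (hline 0).continuousAt.tendsto
  have hdiff : ∀ᶠ z in nhds x, DifferentiableAt ℝ f z :=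
    (hf.eventually (by simp)).mono fun z hz => hz.differentiableAt (by norm_num)
  have hd1 : ∀ᶠ s in nhds (0:ℝ),
      HasDerivAt (fun s : ℝ => f (x + s • v)) (fderiv ℝ f (x + s • v) v) s :=
    (hcont.eventually hdiff).mono fun s hs => hs.hasFDerivAt.comp_hasDerivAt s (hline s)
  have hd2 : HasDerivAt (fun s : ℝ => fderiv ℝ f (x + s • v) v)
      (fderiv ℝ (fun z => fderiv ℝ f z v) x v) 0 := by
    have h1 : ContDiffAt ℝ 1 (fun z => fderiv ℝ f z v) x :=
      (hf.fderiv_right (m := 1) (by norm_num)).clm_apply contDiffAt_const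
    have h2 : DifferentiableAt ℝ (fun z => fderiv ℝ f z v) (x + (0:ℝ) • v) := by
      simpa using h1.differentiableAt (by norm_num)
    have h3 := h2.hasFDerivAt.comp_hasDerivAt 0 (hline 0)
    simp only [zero_smul, add_zero] at h3
    exact h3
  set g : ℝ → ℝ := fun s => f (x + s • v) with hg
  have hmin : IsLocalMin g 0 := by
    have := hcont.eventually h
    refine this.mono fun s hs => ?_
    simpa [hg] using hs
  have hderiv : deriv g =ᶠ[nhds 0] fun s => fderiv ℝ f (x + s • v) v :=
    hd1.mono fun s hs => hs.deriv
  have hdd : deriv (deriv g) 0 = fderiv ℝ (fun z => fderiv ℝ f z v) x v := by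
    rw [hderiv.deriv_eq]; exact hd2.deriv
  by_contra! hneg
  have hmax : IsLocalMax g 0 := isLocalMax_of_deriv_deriv_neg (by rwa [hdd])
    hmin.deriv_eq_zero hd1.self_of_nhds.continuousAt
  have hconst : g =ᶠ[nhds 0] fun _ => g 0 := by
    filter_upwards [hmin, hmax] with s h1 h2 using le_antisymm h2 h1
  have h0 : deriv (deriv g) 0 = 0 := by
    rw [(hconst.deriv).deriv_eq]; simp
  linarith

/-- Indicators of directional derivatives are measurable. -/
theorem measurable_indicator_of_hasLineDerivAt {P : Type*} [NormedAddCommGroup P] [NormedSpace ℝ P]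
    [MeasurableSpace P] [BorelSpace P] {S : Set P} (hS : IsOpen S)
    {f d : P → ℝ} (v : P) (hf : Measurable (S.indicator f))
    (hd : ∀ p ∈ S, HasLineDerivAt ℝ f (d p) p v) : Measurable (S.indicator d) := by
  have hshift : ∀ k : ℕ, Measurable fun p : P => p + ((k:ℝ) + 1)⁻¹ • v := fun k =>
    (continuous_id.add continuous_const).measurable
  refine measurable_of_tendsto_metrizable
    (f := fun (k : ℕ) => S.indicator fun p =>
      ((k:ℝ) + 1) * (S.indicator f (p + ((k:ℝ) + 1)⁻¹ • v) - S.indicator f p)) (fun k =>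
    ((((hf.comp (hshift k)).sub hf).const_mul _).indicator hS.measurableSet)) ?_
  rw [tendsto_pi_nhds]
  intro p
  by_cases hp : p ∈ S
  · simp only [indicator_of_mem hp]
    have hk : Tendsto (fun k : ℕ => ((k:ℝ) + 1)⁻¹) atTop (nhdsWithin 0 {0}ᶜ) := by
      refine tendsto_nhdsWithin_iff.2 ⟨?_, Eventually.of_forall fun k => ?_⟩
      · simpa using tendsto_one_div_add_atTop_nhds_zero_nat (𝕜 := ℝ)
      · simp only [mem_compl_iff, mem_singleton_iff]; positivity
    have h1 := (hasDerivAt_iff_tendsto_slope_zero.1 (hd p hp)).comp hk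
    have h2 : ∀ᶠ k : ℕ in atTop, p + ((k:ℝ) + 1)⁻¹ • v ∈ S := by
      have : Tendsto (fun k : ℕ => p + ((k:ℝ) + 1)⁻¹ • v) atTop (nhds p) := by
        simpa using ((hk.mono_right nhdsWithin_le_nhds).smul_const v).const_add p
      exact this.eventually (hS.mem_nhds hp)
    refine h1.congr' ?_
    filter_upwards [h2] with k hk
    simp [indicator_of_mem hk]
  · simp [indicator_of_notMem hp]

/-- Fatou's lemma for functions bounded below by an integrable function, with conclusions in terms
of Bochner integrals. -/
theorem integrable_and_integral_le_of_tendsto {α : Type*} [MeasurableSpace α] {μ : Measure α}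
    {f : ℕ → α → ℝ} {g m : α → ℝ} {a : ℝ} (hf : ∀ k, Integrable (f k) μ) (hm : Integrable m μ)
    (hmf : ∀ k, ∀ᵐ x ∂μ, m x ≤ f k x)
    (hlim : ∀ᵐ x ∂μ, Tendsto (fun k => f k x) atTop (nhds (g x)))
    (hint : Tendsto (fun k => ∫ x, f k x ∂μ) atTop (nhds a)) :
    Integrable g μ ∧ ∫ x, g x ∂μ ≤ a := by
  have hgmeas : AEStronglyMeasurable g μ :=
    aestronglyMeasurable_of_tendsto_ae atTop (fun k => (hf k).aestronglyMeasurable) hlim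
  have hmg : ∀ᵐ x ∂μ, m x ≤ g x := by
    filter_upwards [ae_all_iff.2 hmf, hlim] with x h1 h2 using ge_of_tendsto' h2 h1
  have hfat : ∫⁻ x, ENNReal.ofReal (g x - m x) ∂μ ≤ ENNReal.ofReal (a - ∫ x, m x ∂μ) := by
    calc ∫⁻ x, ENNReal.ofReal (g x - m x) ∂μ
        = ∫⁻ x, liminf (fun k => ENNReal.ofReal (f k x - m x)) atTop ∂μ := by
          refine lintegral_congr_ae ?_
          filter_upwards [hlim] with x hx
          exact ((ENNReal.continuous_ofReal.tendsto _).comp (hx.sub_const (m x))).liminf_eq.symm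
      _ ≤ liminf (fun k => ∫⁻ x, ENNReal.ofReal (f k x - m x) ∂μ) atTop :=
          lintegral_liminf_le' fun k => ((hf k).sub hm).aemeasurable.ennreal_ofReal
      _ = liminf (fun k => ENNReal.ofReal (∫ x, f k x ∂μ - ∫ x, m x ∂μ)) atTop := by
          congr 1; ext k
          rw [← integral_sub (hf k) hm]
          refine (ofReal_integral_eq_lintegral_ofReal ((hf k).sub hm) ?_).symm
          filter_upwards [hmf k] with x hx using sub_nonneg.2 hx
      _ = ENNReal.ofReal (a - ∫ x, m x ∂μ) :=
          ((ENNReal.continuous_ofReal.tendsto _).comp (hint.sub_const _)).liminf_eq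
  have hgm : Integrable (fun x => g x - m x) μ := by
    refine (lintegral_ofReal_ne_top_iff_integrable (hgmeas.sub hm.aestronglyMeasurable) ?_).1
      (hfat.trans_lt ENNReal.ofReal_lt_top).ne
    filter_upwards [hmg] with x hx using sub_nonneg.2 hx
  have hg : Integrable g μ := (hgm.add hm).congr (ae_of_all _ fun x => sub_add_cancel _ _)
  refine ⟨hg, ?_⟩
  have hnn : 0 ≤ a - ∫ x, m x ∂μ := by
    refine sub_nonneg.2 (ge_of_tendsto' hint fun k => integral_mono_ae hm (hf k) (hmf k))
  rw [← ofReal_integral_eq_lintegral_ofReal hgm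
    (by filter_upwards [hmg] with x hx using sub_nonneg.2 hx),
    ENNReal.ofReal_le_ofReal_iff hnn, integral_sub hg hm] at hfat
  linarith

theorem ContDiffAt.fderiv_apply_const {E : Type*} [NormedAddCommGroup E] [NormedSpace ℝ E]
    {f : E → ℝ} {x : E} (hf : ContDiffAt ℝ 2 f x) (v : E) :
    ContDiffAt ℝ 1 (fun z => fderiv ℝ f z v) x :=
  (hf.fderiv_right (m := 1) (by norm_num)).clm_apply contDiffAt_const

theorem ContDiffAt.continuousAt_fderiv_fderiv {E : Type*} [NormedAddCommGroup E] [NormedSpace ℝ E]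
    {f : E → ℝ} {x : E} (hf : ContDiffAt ℝ 2 f x) (v : E) :
    ContinuousAt (fun y => fderiv ℝ (fun z => fderiv ℝ f z v) y v) x :=
  (((hf.fderiv_apply_const v).fderiv_right (m := 0) (by norm_num)).clm_apply
    contDiffAt_const).continuousAt

theorem Filter.EventuallyEq.euclideanLaplacian_eq {n : ℕ} {f g : EuclideanSpace ℝ (Fin n) → ℝ}
    {x : EuclideanSpace ℝ (Fin n)} (h : f =ᶠ[nhds x] g) :
    euclideanLaplacian f x = euclideanLaplacian g x := by
  unfold euclideanLaplacian
  refine Finset.sum_congr rfl fun i _ => ?_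
  have : (fun z => fderiv ℝ f z (EuclideanSpace.single i 1)) =ᶠ[nhds x]
      fun z => fderiv ℝ g z (EuclideanSpace.single i 1) :=
    (h.fderiv (𝕜 := ℝ)).mono fun z hz => by simp only [hz]
  rw [this.fderiv_eq]

theorem euclideanLaplacian_sub {n : ℕ} {f g : EuclideanSpace ℝ (Fin n) → ℝ}
    {x : EuclideanSpace ℝ (Fin n)} (hf : ContDiffAt ℝ 2 f x) (hg : ContDiffAt ℝ 2 g x) :
    euclideanLaplacian (fun y => f y - g y) x =
      euclideanLaplacian f x - euclideanLaplacian g x := by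
  unfold euclideanLaplacian
  rw [← Finset.sum_sub_distrib]
  refine Finset.sum_congr rfl fun i _ => ?_
  have hd : ∀ {h : EuclideanSpace ℝ (Fin n) → ℝ}, ContDiffAt ℝ 2 h x →
      ∀ᶠ z in nhds x, DifferentiableAt ℝ h z := fun hh =>
    (hh.eventually (by simp)).mono fun z hz => hz.differentiableAt (by norm_num)
  have h1 : (fun z => fderiv ℝ (fun y => f y - g y) z (EuclideanSpace.single i 1)) =ᶠ[nhds x]
      fun z => fderiv ℝ f z (EuclideanSpace.single i 1)
        - fderiv ℝ g z (EuclideanSpace.single i 1) := by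
    filter_upwards [hd hf, hd hg] with z h1 h2
    rw [fderiv_fun_sub h1 h2]; rfl
  rw [h1.fderiv_eq, fderiv_fun_sub ((hf.fderiv_apply_const _).differentiableAt (by norm_num))
    ((hg.fderiv_apply_const _).differentiableAt (by norm_num))]
  rfl

theorem euclideanLaplacian_norm_sub_sq {n : ℕ} (a x : EuclideanSpace ℝ (Fin n)) :
    euclideanLaplacian (fun y => ‖y - a‖ ^ 2) x = 2 * n := by
  unfold euclideanLaplacian
  have h1 : ∀ i : Fin n, (fun z => fderiv ℝ (fun y => ‖y - a‖ ^ 2) z (EuclideanSpace.single i 1))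
      = fun z => 2 * inner ℝ (z - a) (EuclideanSpace.single i (1:ℝ)) := fun i => by
    ext z
    have := ((hasFDerivAt_id z).sub_const a).norm_sq
    rw [HasFDerivAt.fderiv (by simpa using this)]
    simp [inner_sub_left]
  have h2 : ∀ i : Fin n, fderiv ℝ (fun z => fderiv ℝ (fun y => ‖y - a‖ ^ 2) z
      (EuclideanSpace.single i 1)) x (EuclideanSpace.single i 1) = 2 := fun i => by
    rw [h1 i]
    have := (((hasFDerivAt_id x).sub_const a).inner ℝ
      (hasFDerivAt_const (EuclideanSpace.single i (1:ℝ)) x)).const_mul 2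
    rw [HasFDerivAt.fderiv (by simpa using this)]
    simp
  simp [h2, mul_comm]

theorem euclideanLaplacian_comp {n : ℕ} {F : ℝ → ℝ} {φ : EuclideanSpace ℝ (Fin n) → ℝ}
    {x : EuclideanSpace ℝ (Fin n)} (hF : ContDiff ℝ 2 F) (hφ : ContDiffAt ℝ 2 φ x) :
    euclideanLaplacian (fun y => F (φ y)) x =
      deriv (deriv F) (φ x) * ∑ i : Fin n, (fderiv ℝ φ x (EuclideanSpace.single i 1)) ^ 2
        + deriv F (φ x) * euclideanLaplacian φ x := by
  unfold euclideanLaplacian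
  rw [Finset.mul_sum, Finset.mul_sum, ← Finset.sum_add_distrib]
  refine Finset.sum_congr rfl fun i _ => ?_
  set e : EuclideanSpace ℝ (Fin n) := EuclideanSpace.single i 1
  have hd : ∀ᶠ z in nhds x, DifferentiableAt ℝ φ z :=
    (hφ.eventually (by simp)).mono fun z hz => hz.differentiableAt (by norm_num)
  have h1 : (fun z => fderiv ℝ (fun y => F (φ y)) z e) =ᶠ[nhds x]
      fun z => deriv F (φ z) * fderiv ℝ φ z e := by
    filter_upwards [hd] with z hz
    have := ((hF.differentiable (by norm_num)) (φ z)).hasDerivAt.comp_hasFDerivAt z hz.hasFDerivAt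
    rw [HasFDerivAt.fderiv (f := fun y => F (φ y)) this]
    simp
  have hF' : DifferentiableAt ℝ (deriv F) (φ x) := by
    rw [show (2 : WithTop ℕ∞) = 1 + 1 by norm_num, contDiff_succ_iff_deriv] at hF
    exact hF.2.2.differentiable (by norm_num) _
  have h2 := hF'.hasDerivAt.comp_hasFDerivAt x hd.self_of_nhds.hasFDerivAt
  have h3 := h2.mul ((hφ.fderiv_apply_const e).differentiableAt (by norm_num)).hasFDerivAt
  rw [h1.fderiv_eq, HasFDerivAt.fderiv (f := fun z => deriv F (φ z) * fderiv ℝ φ z e) h3]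
  simp only [Function.comp_apply, add_apply, smul_apply,
    smul_eq_mul]
  ring

theorem ContDiffOn.continuousOn_euclideanLaplacian {n : ℕ} {f : EuclideanSpace ℝ (Fin n) → ℝ}
    {O : Set (EuclideanSpace ℝ (Fin n))} (hO : IsOpen O) (hf : ContDiffOn ℝ 2 f O) :
    ContinuousOn (euclideanLaplacian f) O := by
  intro x hx
  refine ContinuousAt.continuousWithinAt ?_
  unfold euclideanLaplacian
  exact tendsto_finsetSum _ fun i _ =>
    ((hf.contDiffAt (hO.mem_nhds hx)).continuousAt_fderiv_fderiv _).tendsto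

theorem integrable_mul_of_tsupport_subset {E : Type*} [NormedAddCommGroup E] [MeasurableSpace E]
    [BorelSpace E] {μ : Measure E} [IsFiniteMeasureOnCompacts μ]
    {f h : E → ℝ} {O : Set E} (hf : Continuous f) (hfc : HasCompactSupport f)
    (hsub : tsupport f ⊆ O) (hh : ContinuousOn h O) : Integrable (fun x => f x * h x) μ := by
  have h1 : IntegrableOn (fun x => f x * h x) (tsupport f) μ :=
    (hf.continuousOn.mul (hh.mono hsub)).integrableOn_compact hfc
  refine (integrableOn_iff_integrable_of_support_subset ?_).1 h1
  intro x hx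
  exact subset_tsupport f (left_ne_zero_of_mul hx)

/-- Green's second identity against a compactly supported `C²` function. -/
theorem integral_mul_euclideanLaplacian_comm {n : ℕ} {ψ g : EuclideanSpace ℝ (Fin n) → ℝ}
    {O : Set (EuclideanSpace ℝ (Fin n))} (hO : IsOpen O) (hψ : ContDiff ℝ 2 ψ)
    (hψc : HasCompactSupport ψ) (hsub : tsupport ψ ⊆ O) (hg : ContDiffOn ℝ 2 g O) :
    ∫ x, ψ x * euclideanLaplacian g x = ∫ x, euclideanLaplacian ψ x * g x := by
  have hgat : ∀ x ∈ O, ContDiffAt ℝ 2 g x := fun x hx => hg.contDiffAt (hO.mem_nhds hx)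
  set e : Fin n → EuclideanSpace ℝ (Fin n) := fun i => EuclideanSpace.single i 1
  have hψ1 : ∀ i, ContDiff ℝ 1 (fun z => fderiv ℝ ψ z (e i)) := fun i =>
    contDiff_iff_contDiffAt.2 fun x => hψ.contDiffAt.fderiv_apply_const _
  have hψ1c : ∀ i, HasCompactSupport (fun z => fderiv ℝ ψ z (e i)) := fun i =>
    hψc.fderiv_apply ℝ (e i)
  have hψ1s : ∀ i, tsupport (fun z => fderiv ℝ ψ z (e i)) ⊆ O := fun i =>
    (tsupport_fderiv_apply_subset ℝ (e i)).trans hsub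
  have hψ2 : ∀ i, Continuous (fun y => fderiv ℝ (fun z => fderiv ℝ ψ z (e i)) y (e i)) := fun i =>
    continuous_iff_continuousAt.2 fun x => hψ.contDiffAt.continuousAt_fderiv_fderiv _
  have hψ2c : ∀ i, HasCompactSupport (fun y => fderiv ℝ (fun z => fderiv ℝ ψ z (e i)) y (e i)) :=
    fun i => (hψ1c i).fderiv_apply ℝ (e i)
  have hψ2s : ∀ i, tsupport (fun y => fderiv ℝ (fun z => fderiv ℝ ψ z (e i)) y (e i)) ⊆ O :=
    fun i => (tsupport_fderiv_apply_subset ℝ (e i)).trans (hψ1s i)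
  have hg1 : ∀ i, ContinuousOn (fun z => fderiv ℝ g z (e i)) O := fun i x hx =>
    ((hgat x hx).fderiv_apply_const _).continuousAt.continuousWithinAt
  have hg2 : ∀ i, ContinuousOn (fun y => fderiv ℝ (fun z => fderiv ℝ g z (e i)) y (e i)) O :=
    fun i x hx => ((hgat x hx).continuousAt_fderiv_fderiv _).continuousWithinAt
  have hψ0 : Continuous ψ := hψ.continuous
  have hstep : ∀ i, ∫ x, ψ x * fderiv ℝ (fun z => fderiv ℝ g z (e i)) x (e i)
      = ∫ x, fderiv ℝ (fun z => fderiv ℝ ψ z (e i)) x (e i) * g x := fun i => by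
    rw [integral_mul_fderiv_eq_neg_fderiv_mul_of_integrable
      (integrable_mul_of_tsupport_subset (hψ1 i).continuous (hψ1c i) (hψ1s i) (hg1 i))
      (integrable_mul_of_tsupport_subset hψ0 hψc hsub (hg2 i))
      (integrable_mul_of_tsupport_subset hψ0 hψc hsub (hg1 i))
      (fun x _ => hψ.differentiable (by norm_num) x)
      (fun x hx => ((hgat x (hsub hx)).fderiv_apply_const _).differentiableAt (by norm_num)),
      integral_mul_fderiv_eq_neg_fderiv_mul_of_integrable
      (integrable_mul_of_tsupport_subset (hψ2 i) (hψ2c i) (hψ2s i) hg.continuousOn)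
      (integrable_mul_of_tsupport_subset (hψ1 i).continuous (hψ1c i) (hψ1s i) (hg1 i))
      (integrable_mul_of_tsupport_subset (hψ1 i).continuous (hψ1c i) (hψ1s i) hg.continuousOn)
      (fun x _ => (hψ1 i).differentiable (by norm_num) x)
      (fun x hx => (hgat x (hψ1s i hx)).differentiableAt (by norm_num)), neg_neg]
  simp only [euclideanLaplacian, Finset.mul_sum, Finset.sum_mul]
  rw [integral_finsetSum _ fun i _ => integrable_mul_of_tsupport_subset hψ0 hψc hsub (hg2 i),
    integral_finsetSum _ fun i _ =>
      integrable_mul_of_tsupport_subset (hψ2 i) (hψ2c i) (hψ2s i) hg.continuousOn]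
  exact Finset.sum_congr rfl fun i _ => hstep i

/-- Testing a nonnegative function against a positive Dirichlet eigenfunction: no regularity of the
eigenfunction up to the boundary is needed. -/
theorem neg_integral_euclideanLaplacian_mul_le {n : ℕ} {Ω O : Set (EuclideanSpace ℝ (Fin n))}
    {φ g : EuclideanSpace ℝ (Fin n) → ℝ} {lam : ℝ} (hΩ : IsOpen Ω) (hΩb : Bornology.IsBounded Ω)
    (hO : IsOpen O) (hΩO : closure Ω ⊆ O) (hlam : 0 ≤ lam)
    (hφ : ContDiffOn ℝ 2 φ Ω) (hφc : ContinuousOn φ (closure Ω)) (hφpos : ∀ x ∈ Ω, 0 < φ x)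
    (hφbd : ∀ x ∈ frontier Ω, φ x = 0) (hφeig : ∀ x ∈ Ω, -euclideanLaplacian φ x = lam * φ x)
    (hg : ContDiffOn ℝ 2 g O) (hg0 : ∀ x ∈ O, 0 ≤ g x) :
    -∫ x in Ω, euclideanLaplacian g x * φ x ≤ lam * ∫ x in Ω, g x * φ x := by
  have hcpt : IsCompact (closure Ω) := hΩb.isCompact_closure
  have hsubO : Ω ⊆ O := subset_closure.trans hΩO
  have hcontint : ∀ {h : EuclideanSpace ℝ (Fin n) → ℝ}, ContinuousOn h (closure Ω) →
      IntegrableOn h Ω := fun hh => (hh.integrableOn_compact hcpt).mono_set subset_closure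
  have hLg : ContinuousOn (euclideanLaplacian g) (closure Ω) :=
    (hg.continuousOn_euclideanLaplacian hO).mono hΩO
  have hgc : ContinuousOn g (closure Ω) := hg.continuousOn.mono hΩO
  set A := ∫ x in Ω, |euclideanLaplacian g x| with hA
  have hA0 : 0 ≤ A := integral_nonneg fun x => abs_nonneg _
  have key : ∀ ε > 0, -∫ x in Ω, euclideanLaplacian g x * φ x
      ≤ lam * (∫ x in Ω, g x * φ x) + 2 * ε * A := by
    intro ε hε
    obtain ⟨F, hF, hF0, hF1, hF1', hF2, hFs⟩ := exists_convex_truncation hε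
    set ψ : EuclideanSpace ℝ (Fin n) → ℝ := Ω.indicator fun x => F (φ x) with hψdef
    set K := closure Ω ∩ φ ⁻¹' Ici ε with hK
    have hKcl : IsClosed K := hφc.preimage_isClosed_of_isClosed isClosed_closure isClosed_Ici
    have hKΩ : K ⊆ Ω := by
      rintro x ⟨hx, hxε⟩
      by_contra hxΩ
      have : φ x = 0 := hφbd x ⟨hx, by rwa [hΩ.interior_eq]⟩
      have : ε ≤ φ x := hxε
      linarith
    have hψK : ∀ x ∉ K, ψ x = 0 := by
      intro x hx
      by_cases hxΩ : x ∈ Ω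
      · rw [hψdef, indicator_of_mem hxΩ]
        refine hF0 _ (le_of_lt ?_)
        by_contra! h
        exact hx ⟨subset_closure hxΩ, h⟩
      · exact indicator_of_notMem hxΩ _
    have hψts : tsupport ψ ⊆ K := closure_minimal
      (fun x hx => by by_contra h; exact hx (hψK x h)) hKcl
    have hψcs : HasCompactSupport ψ :=
      HasCompactSupport.intro (hcpt.of_isClosed_subset hKcl inter_subset_left) hψK
    have hψΩ : ∀ x ∈ Ω, ψ =ᶠ[nhds x] fun y => F (φ y) := fun x hx => by
      filter_upwards [hΩ.mem_nhds hx] with y hy using indicator_of_mem hy _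
    have hψC : ContDiff ℝ 2 ψ := by
      refine contDiff_iff_contDiffAt.2 fun x => ?_
      by_cases hx : x ∈ Ω
      · exact (hF.contDiffAt.comp x (hφ.contDiffAt (hΩ.mem_nhds hx))).congr_of_eventuallyEq
          (hψΩ x hx)
      · refine (contDiffAt_const (c := (0:ℝ))).congr_of_eventuallyEq ?_
        filter_upwards [hKcl.isOpen_compl.mem_nhds fun h => hx (hKΩ h)] with y hy using hψK y hy
    have hgreen := integral_mul_euclideanLaplacian_comm hO hψC hψcs
      ((hψts.trans hKΩ).trans hsubO) hg
    have hL : ∫ x, ψ x * euclideanLaplacian g x = ∫ x in Ω, F (φ x) * euclideanLaplacian g x := by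
      rw [← integral_indicator hΩ.measurableSet]
      congr 1; ext x
      by_cases hx : x ∈ Ω <;> simp [hψdef, hx]
    have hLψ : ∀ x ∉ Ω, euclideanLaplacian ψ x * g x = 0 := fun x hx => by
      have : ψ =ᶠ[nhds x] fun _ => 0 := by
        filter_upwards [hKcl.isOpen_compl.mem_nhds fun h => hx (hKΩ h)] with y hy using hψK y hy
      rw [this.euclideanLaplacian_eq]
      simp [euclideanLaplacian]
    have hR : ∫ x, euclideanLaplacian ψ x * g x = ∫ x in Ω, euclideanLaplacian ψ x * g x :=
      (setIntegral_eq_integral_of_forall_compl_eq_zero hLψ).symm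
    have hLψc : Continuous (euclideanLaplacian ψ) := by
      rw [← continuousOn_univ]
      exact hψC.contDiffOn.continuousOn_euclideanLaplacian isOpen_univ
    have h1 : -(lam * ∫ x in Ω, g x * φ x) ≤ ∫ x in Ω, euclideanLaplacian ψ x * g x := by
      rw [← integral_const_mul, ← integral_neg]
      refine setIntegral_mono_on (hcontint ((continuousOn_const.mul (hgc.mul hφc)).neg))
        (hcontint (hLψc.continuousOn.mul hgc)) hΩ.measurableSet fun x hx => ?_
      rw [(hψΩ x hx).euclideanLaplacian_eq,
        euclideanLaplacian_comp hF (hφ.contDiffAt (hΩ.mem_nhds hx))]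
      have hΔ : euclideanLaplacian φ x = -(lam * φ x) := by linarith [hφeig x hx]
      have hgx := hg0 x (hsubO hx)
      have e1 : 0 ≤ deriv (deriv F) (φ x) *
          ∑ i : Fin n, (fderiv ℝ φ x (EuclideanSpace.single i 1)) ^ 2 :=
        mul_nonneg (hF2 _) (Finset.sum_nonneg fun i _ => sq_nonneg _)
      have e2 : deriv F (φ x) * (lam * φ x) ≤ lam * φ x :=
        mul_le_of_le_one_left (mul_nonneg hlam (hφpos x hx).le) (hF1' _)
      rw [hΔ]
      nlinarith [mul_nonneg hgx e1, mul_nonneg hgx (sub_nonneg.2 e2)]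
    have h2 : (∫ x in Ω, F (φ x) * euclideanLaplacian g x)
        - ∫ x in Ω, euclideanLaplacian g x * φ x ≤ 2 * ε * A := by
      have hi1 : IntegrableOn (fun x => F (φ x) * euclideanLaplacian g x) Ω :=
        hcontint ((hF.continuous.comp_continuousOn hφc).mul hLg)
      have hi2 : IntegrableOn (fun x => euclideanLaplacian g x * φ x) Ω := hcontint (hLg.mul hφc)
      rw [← integral_sub hi1 hi2, hA, ← integral_const_mul]
      refine setIntegral_mono_on (hi1.sub hi2) (hcontint (continuousOn_const.mul hLg.abs))
        hΩ.measurableSet fun x hx => ?_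
      calc F (φ x) * euclideanLaplacian g x - euclideanLaplacian g x * φ x
          = (F (φ x) - φ x) * euclideanLaplacian g x := by ring
        _ ≤ |F (φ x) - φ x| * |euclideanLaplacian g x| := by
            rw [← abs_mul]; exact le_abs_self _
        _ ≤ 2 * ε * |euclideanLaplacian g x| := by
            gcongr; exact hFs _ (hφpos x hx).le
    linarith
  refine le_of_forall_pos_le_add fun δ hδ => ?_
  refine (key (δ / (2 * (A + 1))) (by positivity)).trans ?_
  gcongr
  rw [show 2 * (δ / (2 * (A + 1))) * A = δ * (A / (A + 1)) by field_simp]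
  exact mul_le_of_le_one_right hδ.le ((div_le_one (by positivity)).2 (by linarith))

theorem IsLocalMin.euclideanLaplacian_nonneg {n : ℕ} {f : EuclideanSpace ℝ (Fin n) → ℝ}
    {x : EuclideanSpace ℝ (Fin n)} (h : IsLocalMin f x) (hf : ContDiffAt ℝ 2 f x) :
    0 ≤ euclideanLaplacian f x :=
  Finset.sum_nonneg fun _ _ => h.fderiv_fderiv_nonneg hf _

theorem HasDerivAt.nonpos_of_forall_le_left {f : ℝ → ℝ} {f' a t : ℝ} (hf : HasDerivAt f f' t)
    (hat : a < t) (h : ∀ s ∈ Ioo a t, f t ≤ f s) : f' ≤ 0 := by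
  have h1 : Tendsto (slope f t) (nhdsWithin t (Iio t)) (nhds f') :=
    (hasDerivAt_iff_tendsto_slope.1 hf).mono_left
      (nhdsWithin_mono _ fun s hs => ne_of_lt hs)
  refine le_of_tendsto h1 ?_
  filter_upwards [Ioo_mem_nhdsLT hat] with s hs
  rw [slope_def_field]
  exact div_nonpos_of_nonneg_of_nonpos (sub_nonneg.2 (h s hs)) (by linarith [hs.2])

/-- A supersolution of the heat equation decreases in time at most linearly, locally uniformly in
space: this is comparison with the barrier `u x t₀ - C * (t - t₀) - ‖x - x₀‖ ^ 2`. -/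
theorem exists_forward_lower_bound {n : ℕ} {u : EuclideanSpace ℝ (Fin n) → ℝ → ℝ}
    {O K : Set (EuclideanSpace ℝ (Fin n))} {a b t₀ : ℝ} (hO : IsOpen O) (hK : IsCompact K)
    (hKO : K ⊆ O) (ht₀ : t₀ ∈ Ioo a b)
    (hucont : ContinuousOn (fun p : EuclideanSpace ℝ (Fin n) × ℝ => u p.1 p.2) (O ×ˢ Ioo a b))
    (hux : ∀ t ∈ Ioo a b, ContDiffOn ℝ 2 (fun x => u x t) O)
    (hut : ∀ x ∈ O, ∀ t ∈ Ioo a b, DifferentiableAt ℝ (u x) t)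
    (hsup : ∀ x ∈ O, ∀ t ∈ Ioo a b, 0 ≤ deriv (u x) t - euclideanLaplacian (fun y => u y t) x) :
    ∃ C : ℝ, ∃ δ > 0, t₀ + δ < b ∧ ∀ x ∈ K, ∀ h ∈ Icc 0 δ, u x t₀ - C * h ≤ u x (t₀ + h) := by
  obtain ⟨ρ, hρ, hρO⟩ := hK.exists_cthickening_subset_open hO hKO
  set Kρ := cthickening ρ K
  have hKρ : IsCompact Kρ := hK.cthickening
  obtain ⟨M, hM⟩ := hKρ.exists_bound_of_continuousOn
    (((hux t₀ ht₀).continuousOn_euclideanLaplacian hO).mono hρO)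
  set d := (b - t₀) / 2 with hd
  have hdpos : 0 < d := by have := ht₀.2; rw [hd]; linarith
  have htd : Icc t₀ (t₀ + d) ⊆ Ioo a b := fun s hs =>
    ⟨ht₀.1.trans_le hs.1, hs.2.trans_lt (by rw [hd]; linarith [ht₀.2])⟩
  have huc := (hKρ.prod isCompact_Icc).uniformContinuousOn_of_continuous
    (hucont.mono (prod_mono hρO htd))
  obtain ⟨δ₁, hδ₁, hδ₁u⟩ := Metric.uniformContinuousOn_iff.1 huc (ρ ^ 2) (by positivity)
  set δ := min d (δ₁ / 2) with hδ
  have hδpos : 0 < δ := lt_min hdpos (by linarith)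
  have hδd : δ ≤ d := min_le_left _ _
  have hδδ₁ : δ < δ₁ := (min_le_right _ _).trans_lt (by linarith)
  have hnear : ∀ x ∈ Kρ, ∀ t ∈ Icc t₀ (t₀ + δ), u x t₀ - ρ ^ 2 < u x t := by
    intro x hx t ht
    have := hδ₁u (x, t) ⟨hx, ht.1, ht.2.trans (by linarith)⟩ (x, t₀) ⟨hx, le_rfl, by linarith⟩
      (by
        rw [Prod.dist_eq, dist_self, max_eq_right dist_nonneg, Real.dist_eq,
          abs_of_nonneg (by linarith [ht.1])]
        linarith [ht.2])
    rw [Real.dist_eq, abs_lt] at this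
    linarith [this.1]
  set C := M + 2 * n + 1 with hC
  have hM0 : ∀ x ∈ Kρ, |euclideanLaplacian (fun y => u y t₀) x| ≤ M := hM
  refine ⟨C, δ, hδpos, by rw [hd] at hδd; linarith [ht₀.2], fun x₀ hx₀ h hh => ?_⟩
  have hball : closedBall x₀ ρ ⊆ Kρ := closedBall_subset_cthickening hx₀ ρ
  have hM0' : 0 ≤ M := (abs_nonneg _).trans (hM0 x₀ (hball (mem_closedBall_self hρ.le)))
  have hC0 : 0 ≤ C := by positivity
  have htδ : Icc t₀ (t₀ + δ) ⊆ Ioo a b := (Icc_subset_Icc_right (by linarith)).trans htd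
  set w : EuclideanSpace ℝ (Fin n) × ℝ → ℝ := fun p =>
    u p.1 p.2 - u p.1 t₀ + C * (p.2 - t₀) + ‖p.1 - x₀‖ ^ 2 with hw
  have hwc : ContinuousOn w (closedBall x₀ ρ ×ˢ Icc t₀ (t₀ + δ)) := by
    have h1 : ContinuousOn (fun p : EuclideanSpace ℝ (Fin n) × ℝ => u p.1 p.2)
        (closedBall x₀ ρ ×ˢ Icc t₀ (t₀ + δ)) := hucont.mono (prod_mono (hball.trans hρO) htδ)
    have h2 : ContinuousOn (fun p : EuclideanSpace ℝ (Fin n) × ℝ => u p.1 t₀)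
        (closedBall x₀ ρ ×ˢ Icc t₀ (t₀ + δ)) :=
      (hux t₀ ht₀).continuousOn.comp continuousOn_fst fun p hp => hρO (hball hp.1)
    exact ((h1.sub h2).add (by fun_prop)).add (by fun_prop)
  obtain ⟨⟨y, t⟩, ⟨hy, ht⟩, hmin⟩ :=
    ((isCompact_closedBall x₀ ρ).prod isCompact_Icc).exists_isMinOn
      ⟨(x₀, t₀), mem_closedBall_self hρ.le, le_rfl, by linarith⟩ hwc
  simp only at hy ht
  have hmin' : ∀ x ∈ closedBall x₀ ρ, ∀ s ∈ Icc t₀ (t₀ + δ), w (y, t) ≤ w (x, s) :=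
    fun x hx s hs => hmin (a := (x, s)) ⟨hx, hs⟩
  have hwnn : 0 ≤ w (y, t) := by
    by_contra! hneg
    have hyO : y ∈ O := hρO (hball hy)
    have htt₀ : t₀ < t := by
      refine lt_of_le_of_ne ht.1 fun heq => ?_
      rw [hw, ← heq] at hneg
      simp only [sub_self, mul_zero, zero_add] at hneg
      exact absurd hneg (not_lt.2 (sq_nonneg _))
    have hyint : y ∈ ball x₀ ρ := by
      rw [mem_ball, dist_eq_norm]
      rw [mem_closedBall, dist_eq_norm] at hy
      refine lt_of_le_of_ne hy fun heq => ?_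
      rw [hw] at hneg
      simp only [heq] at hneg
      have := hnear y (hball (by rw [mem_closedBall, dist_eq_norm]; exact hy)) t ht
      linarith [mul_nonneg hC0 (sub_nonneg.2 ht.1)]
    have htab := htδ ht
    have hqc : ContDiffAt ℝ 2 (fun x : EuclideanSpace ℝ (Fin n) => ‖x - x₀‖ ^ 2) y :=
      ((contDiff_id.sub contDiff_const).norm_sq ℝ).contDiffAt
    have hut2 := (hux t htab).contDiffAt (hO.mem_nhds hyO)
    have hgt2 := (hux t₀ ht₀).contDiffAt (hO.mem_nhds hyO)
    have hspace : 0 ≤ euclideanLaplacian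
        (fun x => u x t - (u x t₀ - ‖x - x₀‖ ^ 2)) y := by
      refine IsLocalMin.euclideanLaplacian_nonneg ?_ (hut2.sub (hgt2.sub hqc))
      filter_upwards [isOpen_ball.mem_nhds hyint] with x hx
      have := hmin' x (ball_subset_closedBall hx) t ht
      simp only [hw] at this
      linarith
    rw [euclideanLaplacian_sub hut2 (hgt2.sub hqc), euclideanLaplacian_sub hgt2 hqc,
      euclideanLaplacian_norm_sub_sq] at hspace
    have htime : deriv (u y) t + C ≤ 0 := by
      have hder : HasDerivAt (fun s => u y s + C * s) (deriv (u y) t + C) t := by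
        simpa using (hut y hyO t htab).hasDerivAt.fun_add ((hasDerivAt_id' t).const_mul C)
      refine hder.nonpos_of_forall_le_left htt₀ fun s hs => ?_
      have := hmin' y hy s ⟨hs.1.le, hs.2.le.trans ht.2⟩
      simp only [hw] at this
      linarith
    have h1 := hsup y hyO t htab
    have h2 := (abs_le.1 (hM0 y (hball hy))).1
    linarith
  have := hmin' x₀ (mem_closedBall_self hρ.le) (t₀ + h) ⟨by linarith [hh.1], by linarith [hh.2]⟩
  simp only [hw, sub_self, norm_zero, add_sub_cancel_left] at this hwnn
  linarith

/-- The time derivative of the eigenfunction-weighted mass of a nonnegative supersolution controls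
the weighted integral of the heat operator. -/
theorem integrableOn_and_integral_heat_mul_le {n : ℕ} {u : EuclideanSpace ℝ (Fin n) → ℝ → ℝ}
    {φ : EuclideanSpace ℝ (Fin n) → ℝ} {Ω O : Set (EuclideanSpace ℝ (Fin n))}
    {a b t lam U' : ℝ} (hΩ : IsOpen Ω) (hΩb : Bornology.IsBounded Ω) (hO : IsOpen O)
    (hΩO : closure Ω ⊆ O) (ht : t ∈ Ioo a b) (hlam : 0 ≤ lam)
    (hu0 : ∀ x ∈ O, ∀ t ∈ Ioo a b, 0 ≤ u x t)
    (hucont : ContinuousOn (fun p : EuclideanSpace ℝ (Fin n) × ℝ => u p.1 p.2) (O ×ˢ Ioo a b))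
    (hux : ∀ t ∈ Ioo a b, ContDiffOn ℝ 2 (fun x => u x t) O)
    (hut : ∀ x ∈ O, ∀ t ∈ Ioo a b, DifferentiableAt ℝ (u x) t)
    (hsup : ∀ x ∈ O, ∀ t ∈ Ioo a b, 0 ≤ deriv (u x) t - euclideanLaplacian (fun y => u y t) x)
    (hφ : ContDiffOn ℝ 2 φ Ω) (hφc : ContinuousOn φ (closure Ω)) (hφpos : ∀ x ∈ Ω, 0 < φ x)
    (hφbd : ∀ x ∈ frontier Ω, φ x = 0) (hφeig : ∀ x ∈ Ω, -euclideanLaplacian φ x = lam * φ x)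
    (hU : HasDerivAt (fun s => ∫ x in Ω, u x s * φ x) U' t) :
    IntegrableOn (fun x => (deriv (u x) t - euclideanLaplacian (fun y => u y t) x) * φ x) Ω ∧
      ∫ x in Ω, (deriv (u x) t - euclideanLaplacian (fun y => u y t) x) * φ x
        ≤ U' + lam * ∫ x in Ω, u x t * φ x := by
  have hcpt : IsCompact (closure Ω) := hΩb.isCompact_closure
  have hcontint : ∀ {h : EuclideanSpace ℝ (Fin n) → ℝ}, ContinuousOn h (closure Ω) →
      IntegrableOn h Ω := fun hh => (hh.integrableOn_compact hcpt).mono_set subset_closure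
  have huφ : ∀ s ∈ Ioo a b, IntegrableOn (fun x => u x s * φ x) Ω := fun s hs =>
    hcontint (((hux s hs).continuousOn.mono hΩO).mul hφc)
  have hΔφ : IntegrableOn (fun x => euclideanLaplacian (fun y => u y t) x * φ x) Ω :=
    hcontint ((((hux t ht).continuousOn_euclideanLaplacian hO).mono hΩO).mul hφc)
  obtain ⟨C, δ, hδ, hδb, hlow⟩ :=
    exists_forward_lower_bound hO hcpt hΩO ht hucont hux hut hsup
  set η : ℕ → ℝ := fun k => δ * ((k : ℝ) + 1)⁻¹ with hη
  have hηpos : ∀ k, 0 < η k := fun k => by positivity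
  have hηle : ∀ k, η k ≤ δ := fun k => by
    refine mul_le_of_le_one_right hδ.le (inv_le_one_of_one_le₀ ?_)
    linarith [(Nat.cast_nonneg k : (0:ℝ) ≤ k)]
  have hηlim : Tendsto η atTop (nhdsWithin 0 {0}ᶜ) := by
    refine tendsto_nhdsWithin_iff.2 ⟨?_, Eventually.of_forall fun k => (hηpos k).ne'⟩
    have := (tendsto_one_div_add_atTop_nhds_zero_nat (𝕜 := ℝ)).const_mul δ
    simpa using this
  have hηmem : ∀ k, t + η k ∈ Ioo a b := fun k =>
    ⟨by linarith [hηpos k, ht.1], by linarith [hηle k]⟩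
  have hfatou := integrable_and_integral_le_of_tendsto (μ := volume.restrict Ω)
    (f := fun k x => (η k)⁻¹ * (u x (t + η k) * φ x - u x t * φ x))
    (g := fun x => deriv (u x) t * φ x) (m := fun x => -C * φ x) (a := U')
    (fun k => ((huφ _ (hηmem k)).sub (huφ t ht)).const_mul _)
    (hcontint (continuousOn_const.mul hφc))
    (fun k => by
      filter_upwards [ae_restrict_mem hΩ.measurableSet] with x hx
      have h1 := hlow x (subset_closure hx) (η k) ⟨(hηpos k).le, hηle k⟩
      have h2 : -C ≤ (η k)⁻¹ * (u x (t + η k) - u x t) := by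
        rw [inv_mul_eq_div, le_div_iff₀ (hηpos k)]
        linarith
      have := mul_le_mul_of_nonneg_right h2 (hφpos x hx).le
      linarith)
    (by
      filter_upwards [ae_restrict_mem hΩ.measurableSet] with x hx
      have h1 := (hasDerivAt_iff_tendsto_slope_zero.1
        (hut x (hΩO (subset_closure hx)) t ht).hasDerivAt).comp hηlim
      refine (h1.mul_const (φ x)).congr fun k => ?_
      simp only [Function.comp_apply, smul_eq_mul]
      ring)
    (by
      refine ((hasDerivAt_iff_tendsto_slope_zero.1 hU).comp hηlim).congr fun k => ?_
      rw [integral_const_mul, integral_sub (huφ _ (hηmem k)) (huφ t ht)]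
      rfl)
  have hB := neg_integral_euclideanLaplacian_mul_le hΩ hΩb hO hΩO hlam hφ hφc hφpos hφbd hφeig
    (hux t ht) (fun x hx => hu0 x hx t ht)
  simp only [sub_mul]
  refine ⟨hfatou.1.sub hΔφ, ?_⟩
  rw [integral_sub hfatou.1 hΔφ]
  linarith [hfatou.2]

/-- The heat operator of a continuous function with pointwise derivatives is jointly measurable. -/
theorem measurable_indicator_heat {n : ℕ} {u : EuclideanSpace ℝ (Fin n) → ℝ → ℝ}
    {O : Set (EuclideanSpace ℝ (Fin n))} {I : Set ℝ} (hO : IsOpen O) (hI : IsOpen I)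
    (hucont : ContinuousOn (fun p : EuclideanSpace ℝ (Fin n) × ℝ => u p.1 p.2) (O ×ˢ I))
    (hux : ∀ t ∈ I, ContDiffOn ℝ 2 (fun x => u x t) O)
    (hut : ∀ x ∈ O, ∀ t ∈ I, DifferentiableAt ℝ (u x) t) :
    Measurable ((O ×ˢ I).indicator fun p : EuclideanSpace ℝ (Fin n) × ℝ =>
      deriv (u p.1) p.2 - euclideanLaplacian (fun y => u y p.2) p.1) := by
  have hS : IsOpen (O ×ˢ I) := hO.prod hI
  have hu : Measurable ((O ×ˢ I).indicator
      fun p : EuclideanSpace ℝ (Fin n) × ℝ => u p.1 p.2) := by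
    classical
    rw [← piecewise_eq_indicator]
    exact hucont.measurable_piecewise continuousOn_const hS.measurableSet
  have hspace : ∀ {f : EuclideanSpace ℝ (Fin n) → ℝ → ℝ} (v : EuclideanSpace ℝ (Fin n))
      (p : EuclideanSpace ℝ (Fin n) × ℝ), DifferentiableAt ℝ (fun x => f x p.2) p.1 →
      HasLineDerivAt ℝ (fun q : EuclideanSpace ℝ (Fin n) × ℝ => f q.1 q.2)
        (fderiv ℝ (fun x => f x p.2) p.1 v) p (v, 0) := fun v p h => by
    have := h.hasFDerivAt.hasLineDerivAt v
    unfold HasLineDerivAt at this ⊢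
    simpa using this
  have htime : Measurable ((O ×ˢ I).indicator
      fun p : EuclideanSpace ℝ (Fin n) × ℝ => deriv (u p.1) p.2) := by
    refine measurable_indicator_of_hasLineDerivAt hS (0, 1) hu fun p hp => ?_
    have h1 : HasDerivAt (u p.1) (deriv (u p.1) p.2) (p.2 + 0) := by
      simpa using (hut p.1 hp.1 p.2 hp.2).hasDerivAt
    simpa [HasLineDerivAt] using h1.comp_const_add p.2 0
  have hlap : ∀ i : Fin n, Measurable ((O ×ˢ I).indicator
      fun p : EuclideanSpace ℝ (Fin n) × ℝ =>
        fderiv ℝ (fun z => fderiv ℝ (fun y => u y p.2) z (EuclideanSpace.single i 1)) p.1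
          (EuclideanSpace.single i 1)) := fun i => by
    have hat : ∀ p ∈ O ×ˢ I, ContDiffAt ℝ 2 (fun x => u x p.2) p.1 := fun p hp =>
      (hux p.2 hp.2).contDiffAt (hO.mem_nhds hp.1)
    have h1 := measurable_indicator_of_hasLineDerivAt hS _ hu fun p hp =>
      hspace (EuclideanSpace.single i 1) p ((hat p hp).differentiableAt (by norm_num))
    exact measurable_indicator_of_hasLineDerivAt hS _ h1 fun p hp =>
      hspace (f := fun x t => fderiv ℝ (fun y => u y t) x (EuclideanSpace.single i 1))
        (EuclideanSpace.single i 1) p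
        (((hat p hp).fderiv_apply_const _).differentiableAt (by norm_num))
  convert htime.sub (Finset.measurable_fun_sum Finset.univ fun i _ => hlap i) using 1
  ext p
  by_cases hp : p ∈ O ×ˢ I <;> simp [hp, euclideanLaplacian]

/-- A nonnegative function on `(0, T]` with `U' + lam * U ≥ 0` is bounded, and `U' + lam * U` is
integrable. -/
theorem integrableOn_deriv_add_mul_of_nonneg {U U' : ℝ → ℝ} {lam T : ℝ} (hlam : 0 ≤ lam)
    (hT : 0 < T) (hU' : ∀ t ∈ Ioc 0 T, HasDerivAt U (U' t) t) (hU : ∀ t ∈ Ioc 0 T, 0 ≤ U t)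
    (hnn : ∀ t ∈ Ioc 0 T, 0 ≤ U' t + lam * U t) :
    IntegrableOn (fun t => U' t + lam * U t) (Ioc 0 T) ∧
      ∀ t ∈ Ioc 0 T, U t ≤ exp (lam * T) * U T := by
  set W : ℝ → ℝ := fun t => exp (lam * t) * U t with hW
  set W' : ℝ → ℝ := fun t => exp (lam * t) * (U' t + lam * U t) with hW'
  have hd : ∀ t ∈ Ioc 0 T, HasDerivAt W (W' t) t := fun t ht => by
    have h1 : HasDerivAt (fun t => exp (lam * t)) (exp (lam * t) * lam) t := by
      simpa using ((hasDerivAt_id t).const_mul lam).exp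
    exact (h1.fun_mul (hU' t ht)).congr_deriv (by simp only [hW']; ring)
  have hW'nn : ∀ t ∈ Ioc 0 T, 0 ≤ W' t := fun t ht => mul_nonneg (exp_pos _).le (hnn t ht)
  have hIcc : ∀ {s : ℝ}, 0 < s → Icc s T ⊆ Ioc 0 T := fun hs x hx => ⟨hs.trans_le hx.1, hx.2⟩
  have hcont : ∀ {s : ℝ}, 0 < s → ContinuousOn W (Icc s T) := fun hs x hx =>
    (hd x (hIcc hs hx)).continuousAt.continuousWithinAt
  have hint : ∀ {s : ℝ}, 0 < s → IntegrableOn W' (Ioc s T) := fun hs =>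
    intervalIntegral.integrableOn_deriv_of_nonneg (hcont hs)
      (fun x hx => hd x (hIcc hs (Ioo_subset_Icc_self hx)))
      (fun x hx => hW'nn x (hIcc hs (Ioo_subset_Icc_self hx)))
  have hFTC : ∀ {s : ℝ}, 0 < s → s ≤ T → ∫ x in Ioc s T, W' x = W T - W s := fun hs hsT => by
    rw [← intervalIntegral.integral_of_le hsT]
    refine intervalIntegral.integral_eq_sub_of_hasDerivAt
      (fun x hx => hd x (hIcc hs (by rwa [uIcc_of_le hsT] at hx))) ?_
    rw [intervalIntegrable_iff_integrableOn_Ioc_of_le hsT]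
    exact hint hs
  have hmono : ∀ {s : ℝ}, 0 < s → s ≤ T → W s ≤ W T := fun {s} hs hsT => by
    have : 0 ≤ ∫ x in Ioc s T, W' x := setIntegral_nonneg measurableSet_Ioc
      fun x hx => hW'nn x (hIcc hs (Ioc_subset_Icc_self hx))
    rw [hFTC hs hsT] at this
    linarith
  have hone : ∀ t ∈ Ioc 0 T, 1 ≤ exp (lam * t) := fun t ht =>
    one_le_exp (mul_nonneg hlam ht.1.le)
  constructor
  · have hlim : Tendsto (fun k : ℕ => T * ((k : ℝ) + 1)⁻¹) atTop (nhds 0) := by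
      simpa using (tendsto_one_div_add_atTop_nhds_zero_nat (𝕜 := ℝ)).const_mul T
    have hpos : ∀ k : ℕ, 0 < T * ((k : ℝ) + 1)⁻¹ := fun k => by positivity
    have hle : ∀ k : ℕ, T * ((k : ℝ) + 1)⁻¹ ≤ T := fun k =>
      mul_le_of_le_one_right hT.le
        (inv_le_one_of_one_le₀ (by linarith [(Nat.cast_nonneg k : (0:ℝ) ≤ k)]))
    have hW'int : IntegrableOn W' (Ioc 0 T) := by
      refine integrableOn_Ioc_of_intervalIntegral_norm_bounded_left (I := W T)
        (fun k => hint (hpos k)) hlim (Eventually.of_forall fun k => ?_)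
      rw [setIntegral_congr_fun (g := W') measurableSet_Ioc fun x hx =>
        Real.norm_of_nonneg (hW'nn x (hIcc (hpos k) (Ioc_subset_Icc_self hx))),
        hFTC (hpos k) (hle k)]
      have : 0 ≤ W (T * ((k : ℝ) + 1)⁻¹) :=
        mul_nonneg (exp_pos _).le (hU _ ⟨hpos k, hle k⟩)
      linarith
    refine Integrable.mono' hW'int ?_ ?_
    · have hm : AEStronglyMeasurable (fun t => exp (-(lam * t)) * W' t)
          (volume.restrict (Ioc 0 T)) :=
        (by fun_prop : Continuous fun t => exp (-(lam * t))).aestronglyMeasurable.mul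
          hW'int.aestronglyMeasurable
      refine hm.congr (ae_of_all _ fun t => ?_)
      simp only [hW', ← mul_assoc, ← exp_add, neg_add_cancel, exp_zero, one_mul]
    · filter_upwards [ae_restrict_mem measurableSet_Ioc] with t ht
      rw [Real.norm_of_nonneg (hnn t ht)]
      exact le_mul_of_one_le_left (hnn t ht) (hone t ht)
  · intro t ht
    exact (le_mul_of_one_le_left (hU t ht) (hone t ht)).trans (hmono ht.1 ht.2)

/-- A nonnegative measurable function on a product is integrable if the integrals of its slices are
dominated by an integrable function. -/
theorem integrable_prod_of_slice_integral_le {α β : Type*} [MeasurableSpace α] [MeasurableSpace β]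
    {μ : Measure α} {ν : Measure β} [SFinite μ] [SFinite ν] {f : α × β → ℝ} {m : β → ℝ}
    (hf : AEStronglyMeasurable f (μ.prod ν)) (hm : Integrable m ν)
    (hslice : ∀ᵐ y ∂ν, Integrable (fun x => f (x, y)) μ)
    (hf0 : ∀ᵐ y ∂ν, ∀ᵐ x ∂μ, 0 ≤ f (x, y))
    (hle : ∀ᵐ y ∂ν, ∫ x, f (x, y) ∂μ ≤ m y) : Integrable f (μ.prod ν) := by
  refine (integrable_prod_iff' hf).2 ⟨hslice, hm.mono' hf.norm.prod_swap.integral_prod_right' ?_⟩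
  filter_upwards [hf0, hle] with y h0 hy
  rw [Real.norm_of_nonneg (integral_nonneg fun x => norm_nonneg _)]
  refine (integral_congr_ae ?_).trans_le hy
  filter_upwards [h0] with x hx using Real.norm_of_nonneg hx

theorem supersolution_L1_bounds (n : ℕ) (hn : 1 ≤ n) (lam : ℝ) (hlam : 0 < lam)
    (u H : EuclideanSpace ℝ (Fin n) → ℝ → ℝ)
    (φ₁ : EuclideanSpace ℝ (Fin n) → ℝ) (U U' : ℝ → ℝ)
    -- u is a nonnegative C^{2,1} function on B₄(0) × (0,3)
    (hu0 : ∀ x ∈ Metric.ball (0 : EuclideanSpace ℝ (Fin n)) 4,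
      ∀ t ∈ Set.Ioo (0:ℝ) 3, 0 ≤ u x t)
    (hucont : ContinuousOn (fun p : EuclideanSpace ℝ (Fin n) × ℝ => u p.1 p.2)
      (Metric.ball (0 : EuclideanSpace ℝ (Fin n)) 4 ×ˢ Set.Ioo (0:ℝ) 3))
    (hux : ∀ t ∈ Set.Ioo (0:ℝ) 3,
      ContDiffOn ℝ 2 (fun x => u x t) (Metric.ball (0 : EuclideanSpace ℝ (Fin n)) 4))
    (hut : ∀ x ∈ Metric.ball (0 : EuclideanSpace ℝ (Fin n)) 4,
      ∀ t ∈ Set.Ioo (0:ℝ) 3, DifferentiableAt ℝ (u x) t)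
    -- H is the heat operator applied to u: H = u_t − Δu ≥ 0
    (hH : ∀ x ∈ Metric.ball (0 : EuclideanSpace ℝ (Fin n)) 4, ∀ t ∈ Set.Ioo (0:ℝ) 3,
      H x t = deriv (u x) t - euclideanLaplacian (fun y => u y t) x)
    (hH0 : ∀ x ∈ Metric.ball (0 : EuclideanSpace ℝ (Fin n)) 4,
      ∀ t ∈ Set.Ioo (0:ℝ) 3, 0 ≤ H x t)
    -- φ₁ is the first Dirichlet eigenfunction of −Δ on B₃(0) with eigenvalue lam
    (hφ₁smooth : ContDiffOn ℝ 2 φ₁ (Metric.ball (0 : EuclideanSpace ℝ (Fin n)) 3))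
    (hφ₁cont : ContinuousOn φ₁ (Metric.closedBall (0 : EuclideanSpace ℝ (Fin n)) 3))
    (hφ₁pos : ∀ x ∈ Metric.ball (0 : EuclideanSpace ℝ (Fin n)) 3, 0 < φ₁ x)
    (hφ₁bd : ∀ x : EuclideanSpace ℝ (Fin n), ‖x‖ = 3 → φ₁ x = 0)
    (hφ₁eig : ∀ x ∈ Metric.ball (0 : EuclideanSpace ℝ (Fin n)) 3,
      -euclideanLaplacian φ₁ x = lam * φ₁ x)
    -- U(t) = ∫_{|x|<3} u(x,t) φ₁(x) dx, with derivative U'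
    (hU : ∀ t, U t = ∫ x in Metric.ball (0 : EuclideanSpace ℝ (Fin n)) 3, u x t * φ₁ x)
    (hU' : ∀ t ∈ Set.Ioo (0:ℝ) 3, HasDerivAt U (U' t) t) :
    (∀ t ∈ Set.Ioc (0:ℝ) 2,
      0 ≤ ∫ x in Metric.ball (0 : EuclideanSpace ℝ (Fin n)) 3, H x t * φ₁ x ∧
      ∫ x in Metric.ball (0 : EuclideanSpace ℝ (Fin n)) 3, H x t * φ₁ x
        ≤ U' t + lam * U t) ∧
    IntegrableOn (fun p : EuclideanSpace ℝ (Fin n) × ℝ => u p.1 p.2 * φ₁ p.1)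
      (Metric.ball (0 : EuclideanSpace ℝ (Fin n)) 3 ×ˢ Set.Ioo (0:ℝ) 2) ∧
    IntegrableOn (fun p : EuclideanSpace ℝ (Fin n) × ℝ => H p.1 p.2 * φ₁ p.1)
      (Metric.ball (0 : EuclideanSpace ℝ (Fin n)) 3 ×ˢ Set.Ioo (0:ℝ) 2) ∧
    IntegrableOn (fun p : EuclideanSpace ℝ (Fin n) × ℝ => u p.1 p.2)
      (Metric.ball (0 : EuclideanSpace ℝ (Fin n)) 2 ×ˢ Set.Ioo (0:ℝ) 2) ∧
    IntegrableOn (fun p : EuclideanSpace ℝ (Fin n) × ℝ => H p.1 p.2)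
      (Metric.ball (0 : EuclideanSpace ℝ (Fin n)) 2 ×ˢ Set.Ioo (0:ℝ) 2) := by
  have h34 : closure (ball (0 : EuclideanSpace ℝ (Fin n)) 3) ⊆ ball 0 4 := by
    rw [closure_ball _ (by norm_num)]
    exact closedBall_subset_ball (by norm_num)
  have hsub34 : ball (0 : EuclideanSpace ℝ (Fin n)) 3 ⊆ ball 0 4 :=
    ball_subset_ball (by norm_num)
  have h02 : Ioc (0:ℝ) 2 ⊆ Ioo 0 3 := fun t ht => ⟨ht.1, ht.2.trans_lt (by norm_num)⟩
  have hIoo : Ioo (0:ℝ) 2 ⊆ Ioo 0 3 := Ioo_subset_Ioc_self.trans h02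
  have hφc : ContinuousOn φ₁ (closure (ball (0 : EuclideanSpace ℝ (Fin n)) 3)) := by
    rwa [closure_ball _ (by norm_num)]
  have hφfr : ∀ x ∈ frontier (ball (0 : EuclideanSpace ℝ (Fin n)) 3), φ₁ x = 0 := fun x hx => by
    rw [frontier_ball _ (by norm_num)] at hx
    exact hφ₁bd x (by simpa using hx)
  have hsup : ∀ x ∈ ball (0 : EuclideanSpace ℝ (Fin n)) 4, ∀ t ∈ Ioo (0:ℝ) 3,
      0 ≤ deriv (u x) t - euclideanLaplacian (fun y => u y t) x := fun x hx t ht => by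
    rw [← hH x hx t ht]; exact hH0 x hx t ht
  have hslice : ∀ t ∈ Ioo (0:ℝ) 3, IntegrableOn (fun x => H x t * φ₁ x) (ball 0 3) ∧
      ∫ x in ball (0 : EuclideanSpace ℝ (Fin n)) 3, H x t * φ₁ x ≤ U' t + lam * U t := by
    intro t ht
    have hder : HasDerivAt (fun s => ∫ x in ball (0 : EuclideanSpace ℝ (Fin n)) 3, u x s * φ₁ x)
        (U' t) t := by
      rw [← funext hU]; exact hU' t ht
    have := integrableOn_and_integral_heat_mul_le isOpen_ball isBounded_ball isOpen_ball h34 ht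
      hlam.le hu0 hucont hux hut hsup hφ₁smooth hφc hφ₁pos hφfr hφ₁eig hder
    have hcongr : EqOn (fun x => H x t * φ₁ x)
        (fun x => (deriv (u x) t - euclideanLaplacian (fun y => u y t) x) * φ₁ x) (ball 0 3) :=
      fun x hx => by simp only [hH x (hsub34 hx) t ht]
    rw [integrableOn_congr_fun hcongr measurableSet_ball,
      setIntegral_congr_fun measurableSet_ball hcongr, hU t]
    exact this
  have hHφ0 : ∀ x ∈ ball (0 : EuclideanSpace ℝ (Fin n)) 3, ∀ t ∈ Ioo (0:ℝ) 3,
      0 ≤ H x t * φ₁ x := fun x hx t ht => mul_nonneg (hH0 x (hsub34 hx) t ht) (hφ₁pos x hx).le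
  have huφ0 : ∀ x ∈ ball (0 : EuclideanSpace ℝ (Fin n)) 3, ∀ t ∈ Ioo (0:ℝ) 3,
      0 ≤ u x t * φ₁ x := fun x hx t ht => mul_nonneg (hu0 x (hsub34 hx) t ht) (hφ₁pos x hx).le
  have hHint0 : ∀ t ∈ Ioo (0:ℝ) 3, 0 ≤ ∫ x in ball (0 : EuclideanSpace ℝ (Fin n)) 3, H x t * φ₁ x :=
    fun t ht => setIntegral_nonneg measurableSet_ball fun x hx => hHφ0 x hx t ht
  have hU0 : ∀ t ∈ Ioo (0:ℝ) 3, 0 ≤ U t := fun t ht => by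
    rw [hU]
    exact setIntegral_nonneg measurableSet_ball fun x hx => huφ0 x hx t ht
  obtain ⟨hUint, hUle⟩ := integrableOn_deriv_add_mul_of_nonneg (T := 2) hlam.le (by norm_num)
    (fun t ht => hU' t (h02 ht)) (fun t ht => hU0 t (h02 ht))
    (fun t ht => (hHint0 t (h02 ht)).trans (hslice t (h02 ht)).2)
  have hrestr : ∀ r : ℝ, (volume.restrict (ball (0 : EuclideanSpace ℝ (Fin n)) r ×ˢ Ioo (0:ℝ) 2))
      = (volume.restrict (ball (0 : EuclideanSpace ℝ (Fin n)) r)).prod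
        (volume.restrict (Ioo (0:ℝ) 2)) := fun r => by
    rw [Measure.prod_restrict, Measure.volume_eq_prod]
  have hmeas3 : MeasurableSet (ball (0 : EuclideanSpace ℝ (Fin n)) 3 ×ˢ Ioo (0:ℝ) 2) :=
    measurableSet_ball.prod measurableSet_Ioo
  have hum : AEStronglyMeasurable (fun p : EuclideanSpace ℝ (Fin n) × ℝ => u p.1 p.2)
      (volume.restrict (ball (0 : EuclideanSpace ℝ (Fin n)) 3 ×ˢ Ioo (0:ℝ) 2)) :=
    (hucont.mono (prod_mono hsub34 hIoo)).aestronglyMeasurable hmeas3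
  have hHm : AEStronglyMeasurable (fun p : EuclideanSpace ℝ (Fin n) × ℝ => H p.1 p.2)
      (volume.restrict (ball (0 : EuclideanSpace ℝ (Fin n)) 3 ×ˢ Ioo (0:ℝ) 2)) := by
    have := (measurable_indicator_heat isOpen_ball isOpen_Ioo hucont hux hut).aestronglyMeasurable
      (μ := volume.restrict (ball (0 : EuclideanSpace ℝ (Fin n)) 3 ×ˢ Ioo (0:ℝ) 2))
    refine this.congr ?_
    filter_upwards [ae_restrict_mem hmeas3] with p hp
    have hp' : p ∈ ball (0 : EuclideanSpace ℝ (Fin n)) 4 ×ˢ Ioo (0:ℝ) 3 := ⟨hsub34 hp.1, hIoo hp.2⟩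
    rw [indicator_of_mem hp', hH p.1 hp'.1 p.2 hp'.2]
  have hφm : AEStronglyMeasurable (fun p : EuclideanSpace ℝ (Fin n) × ℝ => φ₁ p.1)
      (volume.restrict (ball (0 : EuclideanSpace ℝ (Fin n)) 3 ×ˢ Ioo (0:ℝ) 2)) :=
    (hφ₁smooth.continuousOn.comp continuousOn_fst fun p hp => hp.1).aestronglyMeasurable hmeas3
  have huφ : IntegrableOn (fun p : EuclideanSpace ℝ (Fin n) × ℝ => u p.1 p.2 * φ₁ p.1)
      (ball (0 : EuclideanSpace ℝ (Fin n)) 3 ×ˢ Ioo (0:ℝ) 2) := by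
    have hm := hum.mul hφm
    unfold IntegrableOn
    rw [hrestr] at hm ⊢
    refine integrable_prod_of_slice_integral_le hm
      (m := fun _ => exp (lam * 2) * U 2) (integrable_const _) ?_ ?_ ?_
    · filter_upwards [ae_restrict_mem measurableSet_Ioo] with t ht
      exact ((((hux t (hIoo ht)).continuousOn.mono h34).mul hφc).integrableOn_compact
        isBounded_ball.isCompact_closure).mono_set subset_closure
    · filter_upwards [ae_restrict_mem measurableSet_Ioo] with t ht
      filter_upwards [ae_restrict_mem measurableSet_ball] with x hx using huφ0 x hx t (hIoo ht)
    · filter_upwards [ae_restrict_mem measurableSet_Ioo] with t ht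
      rw [← hU]
      exact hUle t (Ioo_subset_Ioc_self ht)
  have hHφ : IntegrableOn (fun p : EuclideanSpace ℝ (Fin n) × ℝ => H p.1 p.2 * φ₁ p.1)
      (ball (0 : EuclideanSpace ℝ (Fin n)) 3 ×ˢ Ioo (0:ℝ) 2) := by
    have hm := hHm.mul hφm
    unfold IntegrableOn
    rw [hrestr] at hm ⊢
    refine integrable_prod_of_slice_integral_le hm (hUint.mono_set Ioo_subset_Ioc_self) ?_ ?_ ?_
    · filter_upwards [ae_restrict_mem measurableSet_Ioo] with t ht using (hslice t (hIoo ht)).1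
    · filter_upwards [ae_restrict_mem measurableSet_Ioo] with t ht
      filter_upwards [ae_restrict_mem measurableSet_ball] with x hx using hHφ0 x hx t (hIoo ht)
    · filter_upwards [ae_restrict_mem measurableSet_Ioo] with t ht using (hslice t (hIoo ht)).2
  have hsub23 : closedBall (0 : EuclideanSpace ℝ (Fin n)) 2 ⊆ ball 0 3 :=
    closedBall_subset_ball (by norm_num)
  obtain ⟨z, hz, hzmin⟩ := (isCompact_closedBall (0 : EuclideanSpace ℝ (Fin n)) 2).exists_isMinOn
    ⟨0, mem_closedBall_self (by norm_num)⟩ (hφ₁smooth.continuousOn.mono hsub23)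
  have hc : 0 < φ₁ z := hφ₁pos z (hsub23 hz)
  have hsubset : ball (0 : EuclideanSpace ℝ (Fin n)) 2 ×ˢ Ioo (0:ℝ) 2
      ⊆ ball (0 : EuclideanSpace ℝ (Fin n)) 3 ×ˢ Ioo (0:ℝ) 2 :=
    prod_mono (ball_subset_ball (by norm_num)) Subset.rfl
  have hdrop : ∀ {f : EuclideanSpace ℝ (Fin n) → ℝ → ℝ},
      AEStronglyMeasurable (fun p : EuclideanSpace ℝ (Fin n) × ℝ => f p.1 p.2)
        (volume.restrict (ball (0 : EuclideanSpace ℝ (Fin n)) 3 ×ˢ Ioo (0:ℝ) 2)) →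
      (∀ x ∈ ball (0 : EuclideanSpace ℝ (Fin n)) 4, ∀ t ∈ Ioo (0:ℝ) 3, 0 ≤ f x t) →
      IntegrableOn (fun p : EuclideanSpace ℝ (Fin n) × ℝ => f p.1 p.2 * φ₁ p.1)
        (ball (0 : EuclideanSpace ℝ (Fin n)) 3 ×ˢ Ioo (0:ℝ) 2) →
      IntegrableOn (fun p : EuclideanSpace ℝ (Fin n) × ℝ => f p.1 p.2)
        (ball (0 : EuclideanSpace ℝ (Fin n)) 2 ×ˢ Ioo (0:ℝ) 2) := by
    intro f hfm hf0 hf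
    refine Integrable.mono' ((hf.mono_set hsubset).const_mul (φ₁ z)⁻¹)
      (hfm.mono_measure (Measure.restrict_mono hsubset le_rfl)) ?_
    filter_upwards [ae_restrict_mem (measurableSet_ball.prod measurableSet_Ioo)] with p hp
    have hfp := hf0 p.1 (hsub34 (hsubset hp).1) p.2 (hIoo hp.2)
    have hφp : φ₁ z ≤ φ₁ p.1 := hzmin (ball_subset_closedBall hp.1)
    rw [Real.norm_of_nonneg hfp, inv_mul_eq_div, le_div_iff₀ hc]
    exact mul_le_mul_of_nonneg_left hφp hfp
  exact ⟨fun t ht => ⟨hHint0 t (h02 ht), (hslice t (h02 ht)).2⟩, huφ, hHφ,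
    hdrop hum hu0 huφ, hdrop hHm hH0 hHφ⟩
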